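/- arXiv:1904.01393 — 2 statements merged into one kernel-verified Lean document; each statement's English description precedes it below -/
import Mathlib

section
/- Let 1 ≤ λ₁ ≤ λ₂, a ∈ ℝ, b ≥ 0, and define ψ(n,m₁,m₂) = 2^{na}·(2^n + 2^{nλ₁} + 2^{nλ₂} + 2^{nλ₁}|m₁| + 2^{nλ₂}|m₂|)^{-b} for (n,m₁,m₂) ∈ ℤ³. Then sup over ℤ³ of ψ is finite if and only if b ≤ a ≤ b·λ₂. -/
noncomputable def shearPsi (l1 l2 a b : ℝ) (n m₁ m₂ : ℤ) : ℝ :=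
  (2 : ℝ) ^ ((n : ℝ) * a) *
    ((2 : ℝ) ^ (n : ℝ) + (2 : ℝ) ^ ((n : ℝ) * l1) + (2 : ℝ) ^ ((n : ℝ) * l2)
      + (2 : ℝ) ^ ((n : ℝ) * l1) * |(m₁ : ℝ)| + (2 : ℝ) ^ ((n : ℝ) * l2) * |(m₂ : ℝ)|) ^ (-b)

theorem aux_unb (c K M : ℝ) (hK : 0 < K) (h : ∀ k : ℕ, K * (2:ℝ) ^ ((k:ℝ) * c) ≤ M) : c ≤ 0 := by
  by_contra hc
  push Not at hc
  have h2 : (1:ℝ) < (2:ℝ) ^ c := Real.one_lt_rpow (by norm_num) hc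
  obtain ⟨k, hk⟩ := pow_unbounded_of_one_lt (M / K) h2
  have := h k
  rw [mul_comm (k:ℝ) c, Real.rpow_mul (by norm_num), Real.rpow_natCast] at this
  rw [div_lt_iff₀ hK] at hk
  linarith

theorem aux_eq (x a b l K : ℝ) (hK : 0 < K) :
    (2:ℝ) ^ (x * a) * (K * (2:ℝ) ^ (x * l)) ^ (-b) = K ^ (-b) * (2:ℝ) ^ (x * (a - b * l)) := by
  rw [Real.mul_rpow hK.le (by positivity), ← Real.rpow_mul (by norm_num), mul_left_comm,
    ← Real.rpow_add (by norm_num)]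
  ring_nf

theorem aux_up (x a b l S : ℝ) (hb : 0 ≤ b) (hS : (2:ℝ) ^ (x * l) ≤ S) (hx : x * (a - b * l) ≤ 0) :
    (2:ℝ) ^ (x * a) * S ^ (-b) ≤ 1 := by
  have h0 : (0:ℝ) < (2:ℝ) ^ (x * l) := by positivity
  have h := Real.rpow_le_rpow_of_nonpos h0 hS (neg_nonpos.2 hb)
  have e := aux_eq x a b l 1 one_pos
  rw [one_mul, Real.one_rpow, one_mul] at e
  calc _ ≤ (2:ℝ) ^ (x * a) * ((2:ℝ) ^ (x * l)) ^ (-b) := by gcongr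
    _ = _ := e
    _ ≤ 1 := Real.rpow_le_one_of_one_le_of_nonpos (by norm_num) hx

theorem aux_low (x a b l S M : ℝ) (hb : 0 ≤ b) (hS0 : 0 < S) (hS : S ≤ 3 * (2:ℝ) ^ (x * l))
    (h : (2:ℝ) ^ (x * a) * S ^ (-b) ≤ M) : (3:ℝ) ^ (-b) * (2:ℝ) ^ (x * (a - b * l)) ≤ M := by
  have h' := Real.rpow_le_rpow_of_nonpos hS0 hS (neg_nonpos.2 hb)
  rw [← aux_eq x a b l 3 (by norm_num)]
  refine le_trans ?_ h
  gcongr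

theorem shearPsi_bounded_iff (l1 l2 a b : ℝ) (h1 : 1 ≤ l1) (h12 : l1 ≤ l2) (hb : 0 ≤ b) :
    (∃ M : ℝ, ∀ n m₁ m₂ : ℤ, shearPsi l1 l2 a b n m₁ m₂ ≤ M) ↔ (b ≤ a ∧ a ≤ b * l2) := by
  constructor
  · rintro ⟨M, hM⟩
    constructor
    · have : b - a ≤ 0 := by
        refine aux_unb _ ((3:ℝ) ^ (-b)) M (by positivity) fun k => ?_
        have h := hM (-(k:ℤ)) 0 0
        unfold shearPsi at h
        have hk : (0:ℝ) ≤ k := k.cast_nonneg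
        have e1 : (2:ℝ) ^ ((-(k:ℝ)) * l1) ≤ (2:ℝ) ^ (-(k:ℝ)) :=
          Real.rpow_le_rpow_of_exponent_le (by norm_num) (by nlinarith)
        have e2 : (2:ℝ) ^ ((-(k:ℝ)) * l2) ≤ (2:ℝ) ^ (-(k:ℝ)) :=
          Real.rpow_le_rpow_of_exponent_le (by norm_num) (by nlinarith)
        push_cast at h
        have := aux_low (-(k:ℝ)) a b 1 _ M hb (by positivity)
          (by rw [abs_zero, mul_one]; linarith) h
        convert this using 3
        ring
      linarith
    · have : a - b * l2 ≤ 0 := by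
        refine aux_unb _ ((3:ℝ) ^ (-b)) M (by positivity) fun k => ?_
        have h := hM (k:ℤ) 0 0
        unfold shearPsi at h
        have hk : (0:ℝ) ≤ k := k.cast_nonneg
        have e1 : (2:ℝ) ^ ((k:ℝ) * l1) ≤ (2:ℝ) ^ ((k:ℝ) * l2) :=
          Real.rpow_le_rpow_of_exponent_le (by norm_num) (by nlinarith)
        have e2 : (2:ℝ) ^ (k:ℝ) ≤ (2:ℝ) ^ ((k:ℝ) * l2) :=
          Real.rpow_le_rpow_of_exponent_le (by norm_num) (by nlinarith)
        simp only [Int.cast_natCast, Int.cast_zero] at h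
        exact aux_low (k:ℝ) a b l2 _ M hb (by positivity)
          (by rw [abs_zero]; linarith) h
      linarith
  · rintro ⟨hba, hal⟩
    refine ⟨1, fun n m₁ m₂ => ?_⟩
    unfold shearPsi
    have p0 : (0:ℝ) < (2:ℝ) ^ (n:ℝ) := by positivity
    have p1 : (0:ℝ) < (2:ℝ) ^ ((n:ℝ) * l1) := by positivity
    have p2 : (0:ℝ) < (2:ℝ) ^ ((n:ℝ) * l2) := by positivity
    have q1 := mul_nonneg p1.le (abs_nonneg (m₁:ℝ))
    have q2 := mul_nonneg p2.le (abs_nonneg (m₂:ℝ))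
    rcases le_total 0 (n:ℝ) with hn | hn
    · exact aux_up _ a b l2 _ hb (by linarith) (by nlinarith)
    · exact aux_up _ a b 1 _ hb (by rw [mul_one]; linarith) (by nlinarith)
end

section
/- Let 1 ≤ λ₁ ≤ λ₂, a ∈ ℝ, b ≥ 0, and θ ∈ (0, ∞). Define ψ(n,m₁,m₂) = 2^{na}·(2^n + 2^{nλ₁} + 2^{nλ₂} + 2^{nλ₁}|m₁| + 2^{nλ₂}|m₂|)^{-b}. Then ∑_{(n,m₁,m₂)∈ℤ³} ψ(n,m₁,m₂)^θ < ∞ if and only if b·θ > 2 and (λ₁ + λ₂ - 2)/θ + b < a < (λ₁ - λ₂)/θ + b·λ₂. -/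
lemma shear_aux_rpow (l1 l2 a b θ : ℝ) (n m₁ m₂ : ℤ) :
    (shearPsi l1 l2 a b n m₁ m₂) ^ θ = (2 : ℝ) ^ ((n : ℝ) * (a * θ)) *
    ((2 : ℝ) ^ (n : ℝ) + (2 : ℝ) ^ ((n : ℝ) * l1) + (2 : ℝ) ^ ((n : ℝ) * l2)
      + (2 : ℝ) ^ ((n : ℝ) * l1) * |(m₁ : ℝ)| + (2 : ℝ) ^ ((n : ℝ) * l2) * |(m₂ : ℝ)|)
        ^ (-(b * θ)) := by
  unfold shearPsi
  rw [Real.mul_rpow (by positivity) (by positivity), ← Real.rpow_mul (by positivity),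
    ← Real.rpow_mul (by positivity)]
  congr 2 <;> ring

lemma shear_aux_nec {ι : Type*} (f : ι → ℝ) (hf : Summable f)
    (B : ℕ → Finset ι) (hB : ∀ p, ∀ᶠ k in Filter.atTop, p ∉ B k) (N c : ℕ → ℝ) (C e : ℝ)
    (hC : 0 < C) (hN : ∀ k, N k ≤ (B k).card) (hc : ∀ k, 0 ≤ c k)
    (hfc : ∀ k, ∀ p ∈ B k, c k ≤ f p)
    (hNc : ∀ k : ℕ, C * (2 : ℝ) ^ ((k : ℝ) * e) ≤ N k * c k) : e < 0 := by
  by_contra! he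
  have h := summable_iff_vanishing_norm.1 hf C hC
  obtain ⟨s, hs⟩ := h
  have h2 : ∀ᶠ k in Filter.atTop, ∀ p ∈ s, p ∉ B k :=
    (Filter.eventually_all_finset s).2 (fun p _ => hB p)
  obtain ⟨k, hk⟩ := h2.exists
  have h3 := hs (B k) (Finset.disjoint_left.2 (fun p hp hp' => hk p hp' hp))
  have h4 : N k * c k ≤ ∑ p ∈ B k, f p := by
    calc N k * c k ≤ (B k).card * c k := mul_le_mul_of_nonneg_right (hN k) (hc k)
      _ = ∑ p ∈ B k, c k := by simp
      _ ≤ _ := Finset.sum_le_sum (hfc k)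
  have h5 : (1 : ℝ) ≤ (2 : ℝ) ^ ((k : ℝ) * e) :=
    Real.one_le_rpow (by norm_num) (by positivity)
  have h6 := hNc k
  have h7 := le_abs_self (∑ p ∈ B k, f p)
  rw [Real.norm_eq_abs] at h3
  nlinarith

lemma shear_aux_int (t : ℝ) (ht : 1 < t) : Summable (fun m : ℤ => (1 + |(m : ℝ)|) ^ (-t)) := by
  have h := (Real.summable_one_div_nat_add_rpow 1 t).2 ht
  have h' : Summable (fun n : ℕ => (1 + |(n : ℝ)|) ^ (-t)) := by
    refine h.congr fun n => ?_
    have : (0 : ℝ) ≤ n := by positivity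
    rw [abs_of_nonneg this, abs_of_nonneg (by positivity), Real.rpow_neg (by positivity), one_div,
      add_comm]
  apply Summable.of_nat_of_neg
  · simpa using h'
  · simpa using h'

lemma shear_aux_geom (x : ℝ) (hx : x < 0) : Summable (fun n : ℕ => (2 : ℝ) ^ ((n : ℝ) * x)) := by
  have : Summable (fun n : ℕ => ((2 : ℝ) ^ x) ^ n) :=
    summable_geometric_of_lt_one (by positivity) (Real.rpow_lt_one_of_one_lt_of_neg (by norm_num) hx)
  refine this.congr fun n => ?_
  rw [← Real.rpow_natCast, ← Real.rpow_mul (by norm_num), mul_comm]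

lemma shear_aux_suff (l1 l2 α s : ℝ) (h1 : 1 ≤ l1) (h12 : l1 ≤ l2) (hs : 2 < s)
    (hA : α < l1 - l2 + s * l2) (hB : l1 + l2 - 2 + s < α) :
    Summable (fun p : ℤ × ℤ × ℤ => (2 : ℝ) ^ ((p.1 : ℝ) * α) *
    ((2 : ℝ) ^ (p.1 : ℝ) + (2 : ℝ) ^ ((p.1 : ℝ) * l1) + (2 : ℝ) ^ ((p.1 : ℝ) * l2)
      + (2 : ℝ) ^ ((p.1 : ℝ) * l1) * |(p.2.1 : ℝ)| + (2 : ℝ) ^ ((p.1 : ℝ) * l2) * |(p.2.2 : ℝ)|)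
        ^ (-s)) := by
  obtain ⟨t, ht, ht1, ht2, ht3⟩ : ∃ t : ℝ, 1 < t ∧ 0 ≤ s - 2 * t ∧
      α + l2 * (-(s - 2 * t)) + l1 * (-t) + l2 * (-t) < 0 ∧
      0 < α + (-(s - 2 * t)) + l1 * (-t) + l2 * (-t) := by
    obtain ⟨ε, hε, h⟩ := exists_pos_mul_lt
      (a := min (s - 2) (min (l1 - l2 + s * l2 - α) (α - (l1 + l2 - 2 + s))))
      (by simp only [lt_min_iff]; refine ⟨?_, ?_, ?_⟩ <;> linarith) (l1 + l2 + 2)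
    simp only [lt_min_iff] at h
    obtain ⟨ha, hb, hc⟩ := h
    refine ⟨1 + ε, by linarith, ?_, ?_, ?_⟩ <;> nlinarith
  set X : ℤ → ℝ := fun n => (2 : ℝ) ^ (n : ℝ) + (2 : ℝ) ^ ((n : ℝ) * l1) + (2 : ℝ) ^ ((n : ℝ) * l2)
    with hX
  set g : ℤ → ℝ := fun n => (2 : ℝ) ^ ((n : ℝ) * α) * (X n) ^ (-(s - 2 * t)) *
    ((2 : ℝ) ^ ((n : ℝ) * l1)) ^ (-t) * ((2 : ℝ) ^ ((n : ℝ) * l2)) ^ (-t) with hg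
  have hXp : ∀ n, 0 < X n := fun n => by simp only [hX]; positivity
  have hg0 : ∀ n, 0 ≤ g n := fun n => by
    have := hXp n
    simp only [hg]; positivity
  have key : ∀ (n : ℤ) (r : ℝ), (2 : ℝ) ^ ((n : ℝ) * r) ≤ X n →
      g n ≤ (2 : ℝ) ^ ((n : ℝ) * (α + r * (-(s - 2 * t)) + l1 * (-t) + l2 * (-t))) := by
    intro n r hr
    have h1 : (X n) ^ (-(s - 2 * t)) ≤ ((2 : ℝ) ^ ((n : ℝ) * r)) ^ (-(s - 2 * t)) :=
      Real.rpow_le_rpow_of_nonpos (by positivity) hr (by linarith)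
    calc g n ≤ (2 : ℝ) ^ ((n : ℝ) * α) * ((2 : ℝ) ^ ((n : ℝ) * r)) ^ (-(s - 2 * t)) *
        ((2 : ℝ) ^ ((n : ℝ) * l1)) ^ (-t) * ((2 : ℝ) ^ ((n : ℝ) * l2)) ^ (-t) := by
          simp only [hg]; gcongr
      _ = _ := by
        simp only [← Real.rpow_mul (show (0 : ℝ) ≤ 2 by norm_num)]
        simp only [← Real.rpow_add (show (0 : ℝ) < 2 by norm_num)]
        congr 1; ring
  have hgs : Summable g := by
    apply Summable.of_nat_of_neg
    · refine Summable.of_nonneg_of_le (fun n => hg0 _) (fun n => ?_) (shear_aux_geom _ ht2)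
      have := key n l2 (by
        simp only [hX]
        have h1 : (0 : ℝ) < (2 : ℝ) ^ (((n : ℤ) : ℝ)) := by positivity
        have h2 : (0 : ℝ) < (2 : ℝ) ^ (((n : ℤ) : ℝ) * l1) := by positivity
        linarith)
      simpa using this
    · refine Summable.of_nonneg_of_le (fun n => hg0 _) (fun n => ?_)
        (shear_aux_geom (-(α + (-(s - 2 * t)) + l1 * (-t) + l2 * (-t))) (by linarith))
      have := key (-n) 1 (by
        simp only [hX, mul_one]
        have h1 : (0 : ℝ) < (2 : ℝ) ^ (((-n : ℤ) : ℝ) * l2) := by positivity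
        have h2 : (0 : ℝ) < (2 : ℝ) ^ (((-n : ℤ) : ℝ) * l1) := by positivity
        linarith)
      refine this.trans (le_of_eq ?_)
      congr 1; push_cast; ring
  have hm := shear_aux_int t ht
  have hmm := hm.mul_of_nonneg hm (fun m => by positivity) (fun m => by positivity)
  have hall := hgs.mul_of_nonneg hmm hg0 (fun m => by simp only [Pi.zero_apply]; positivity)
  refine Summable.of_nonneg_of_le (fun p => by positivity) (fun p => ?_) hall
  obtain ⟨n, m, k⟩ := p
  simp only
  have hP : (0 : ℝ) < (2 : ℝ) ^ ((n : ℝ) * l1) := by positivity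
  have hQ : (0 : ℝ) < (2 : ℝ) ^ ((n : ℝ) * l2) := by positivity
  have hR : (0 : ℝ) < (2 : ℝ) ^ (n : ℝ) := by positivity
  have hXn := hXp n
  have hXe : X n = (2 : ℝ) ^ (n : ℝ) + (2 : ℝ) ^ ((n : ℝ) * l1) + (2 : ℝ) ^ ((n : ℝ) * l2) := rfl
  rw [← hXe]
  simp only [hg]
  set P := (2 : ℝ) ^ ((n : ℝ) * l1)
  set Q := (2 : ℝ) ^ ((n : ℝ) * l2)
  have hm0 : 0 ≤ |(m : ℝ)| := abs_nonneg _
  have hk0 : 0 ≤ |(k : ℝ)| := abs_nonneg _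
  have hPm : 0 ≤ P * |(m : ℝ)| := by positivity
  have hQk : 0 ≤ Q * |(k : ℝ)| := by positivity
  set D := X n + P * |(m : ℝ)| + Q * |(k : ℝ)|
  have hD : 0 < D := by positivity
  have e1 : D ^ (-s) = D ^ (-(s - 2 * t)) * D ^ (-t) * D ^ (-t) := by
    rw [← Real.rpow_add hD, ← Real.rpow_add hD]; congr 1; ring
  have i1 : D ^ (-(s - 2 * t)) ≤ (X n) ^ (-(s - 2 * t)) :=
    Real.rpow_le_rpow_of_nonpos hXn (by simp only [D]; linarith) (by linarith)
  have i2 : D ^ (-t) ≤ P ^ (-t) * (1 + |(m : ℝ)|) ^ (-t) := by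
    rw [← Real.mul_rpow hP.le (by positivity)]
    exact Real.rpow_le_rpow_of_nonpos (by positivity) (by simp only [D]; linarith) (by linarith)
  have i3 : D ^ (-t) ≤ Q ^ (-t) * (1 + |(k : ℝ)|) ^ (-t) := by
    rw [← Real.mul_rpow hQ.le (by positivity)]
    exact Real.rpow_le_rpow_of_nonpos (by positivity) (by simp only [D]; linarith) (by linarith)
  rw [e1]
  calc _ ≤ (2 : ℝ) ^ ((n : ℝ) * α) * ((X n) ^ (-(s - 2 * t)) * (P ^ (-t) * (1 + |(m : ℝ)|) ^ (-t))
        * (Q ^ (-t) * (1 + |(k : ℝ)|) ^ (-t))) := by gcongr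
    _ = _ := by ring

/-- the box at level `n` -/
noncomputable def shearBox (n u v : ℤ) (A B : ℝ) : Finset (ℤ × ℤ × ℤ) :=
  {n} ×ˢ (Finset.Ico u (u + ⌈A⌉) ×ˢ Finset.Ico v (v + ⌈B⌉))

lemma shearBox_card (n u v : ℤ) (A B : ℝ) (hA : 0 ≤ A) (hB : 0 ≤ B) :
    A * B ≤ (shearBox n u v A B).card := by
  have h1 : (0 : ℤ) ≤ ⌈A⌉ := Int.ceil_nonneg hA
  have h2 : (0 : ℤ) ≤ ⌈B⌉ := Int.ceil_nonneg hB
  have e1 : ((⌈A⌉.toNat : ℕ) : ℝ) = (⌈A⌉ : ℝ) := by exact_mod_cast Int.toNat_of_nonneg h1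
  have e2 : ((⌈B⌉.toNat : ℕ) : ℝ) = (⌈B⌉ : ℝ) := by exact_mod_cast Int.toNat_of_nonneg h2
  simp only [shearBox, Finset.card_product, Finset.card_singleton, Int.card_Ico, one_mul,
    add_sub_cancel_left]
  push_cast
  rw [e1, e2]
  exact mul_le_mul (Int.le_ceil A) (Int.le_ceil B) hB (by exact_mod_cast h1)

lemma shearBox_mem (n u v : ℤ) (A B : ℝ) (p : ℤ × ℤ × ℤ) (hp : p ∈ shearBox n u v A B)
    (hu : 0 ≤ u) (hv : 0 ≤ v) :
    p.1 = n ∧ u ≤ p.2.1 ∧ |(p.2.1 : ℝ)| ≤ u + A ∧ |(p.2.2 : ℝ)| ≤ v + B := by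
  obtain ⟨x, y, z⟩ := p
  simp only [shearBox, Finset.mem_product, Finset.mem_singleton, Finset.mem_Ico] at hp
  obtain ⟨h1, ⟨h2, h3⟩, h4, h5⟩ := hp
  have h6 : y - u < ⌈A⌉ := by omega
  have h7 : z - v < ⌈B⌉ := by omega
  rw [Int.lt_ceil] at h6 h7
  push_cast at h6 h7
  refine ⟨h1, h2, ?_, ?_⟩
  · rw [abs_of_nonneg (by exact_mod_cast hu.trans h2)]; simp only; linarith
  · rw [abs_of_nonneg (by exact_mod_cast hv.trans h4)]; simp only; linarith

/-- necessity on boxes -/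
lemma shear_aux_box (l1 l2 α s : ℝ) (hs : 0 ≤ s)
    (hf : Summable (fun p : ℤ × ℤ × ℤ => (2 : ℝ) ^ ((p.1 : ℝ) * α) *
    ((2 : ℝ) ^ (p.1 : ℝ) + (2 : ℝ) ^ ((p.1 : ℝ) * l1) + (2 : ℝ) ^ ((p.1 : ℝ) * l2)
      + (2 : ℝ) ^ ((p.1 : ℝ) * l1) * |(p.2.1 : ℝ)| + (2 : ℝ) ^ ((p.1 : ℝ) * l2) * |(p.2.2 : ℝ)|)
        ^ (-s)))
    (n u : ℕ → ℤ) (hu : ∀ k, 0 ≤ u k)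
    (hesc : ∀ x y : ℤ, ∀ᶠ k in Filter.atTop, ¬ (x = n k ∧ u k ≤ y))
    (ν x y z : ℝ) (hn : ∀ k, (n k : ℝ) = k * ν)
    (hD : ∀ k : ℕ, (2 : ℝ) ^ (n k : ℝ) + (2 : ℝ) ^ ((n k : ℝ) * l1) + (2 : ℝ) ^ ((n k : ℝ) * l2)
      + (2 : ℝ) ^ ((n k : ℝ) * l1) * (u k + (2 : ℝ) ^ ((k : ℝ) * x))
      + (2 : ℝ) ^ ((n k : ℝ) * l2) * (2 : ℝ) ^ ((k : ℝ) * y) ≤ 6 * (2 : ℝ) ^ ((k : ℝ) * z)) :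
    x + y + ν * α - z * s < 0 := by
  refine shear_aux_nec _ hf (fun k => shearBox (n k) (u k) 0 (2 ^ ((k : ℝ) * x)) (2 ^ ((k : ℝ) * y)))
    ?_ (fun k => 2 ^ ((k : ℝ) * x) * 2 ^ ((k : ℝ) * y))
    (fun k => 2 ^ ((n k : ℝ) * α) * (6 * (2 : ℝ) ^ ((k : ℝ) * z)) ^ (-s)) (6 ^ (-s)) _
    (by positivity) (fun k => shearBox_card _ _ _ _ _ (by positivity) (by positivity))
    (fun k => by positivity) ?_ ?_
  · intro p
    filter_upwards [hesc p.1 p.2.1] with k hk hp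
    have := shearBox_mem _ _ _ _ _ p hp (hu k) le_rfl
    exact hk ⟨this.1, this.2.1⟩
  · intro k p hp
    obtain ⟨h1, -, h2, h3⟩ := shearBox_mem _ _ _ _ _ p hp (hu k) le_rfl
    simp only [h1]
    push_cast at h3
    rw [zero_add] at h3
    refine mul_le_mul_of_nonneg_left ?_ (by positivity)
    refine Real.rpow_le_rpow_of_nonpos (by positivity) ((hD k).trans' ?_) (by linarith)
    gcongr
  · intro k
    rw [hn, Real.mul_rpow (by norm_num) (by positivity), ← Real.rpow_mul (by norm_num)]
    refine le_of_eq ?_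
    rw [show (k : ℝ) * (x + y + ν * α - z * s)
      = k * x + k * y + k * ν * α + k * z * (-s) by ring]
    simp only [Real.rpow_add (show (0 : ℝ) < 2 by norm_num)]
    ring

theorem shearPsi_summable_iff_case1 (l1 l2 a b θ : ℝ) (h1 : 1 ≤ l1) (h12 : l1 ≤ l2)
    (hb : 0 ≤ b) (hθ : 0 < θ) :
    Summable (fun p : ℤ × ℤ × ℤ => (shearPsi l1 l2 a b p.1 p.2.1 p.2.2) ^ θ) ↔
      (2 < b * θ ∧ (l1 + l2 - 2) / θ + b < a ∧ a < (l1 - l2) / θ + b * l2) := by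
  simp only [shear_aux_rpow]
  have e1 : (l1 + l2 - 2) / θ + b < a ↔ l1 + l2 - 2 + b * θ < a * θ := by
    rw [show (l1 + l2 - 2) / θ + b = (l1 + l2 - 2 + b * θ) / θ by field_simp, div_lt_iff₀ hθ]
  have e2 : a < (l1 - l2) / θ + b * l2 ↔ a * θ < l1 - l2 + b * θ * l2 := by
    rw [show (l1 - l2) / θ + b * l2 = (l1 - l2 + b * θ * l2) / θ by field_simp, lt_div_iff₀ hθ]
  rw [e1, e2]
  have hs : 0 ≤ b * θ := by positivity
  generalize b * θ = s at *
  generalize a * θ = α at *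
  have two : (1 : ℝ) ≤ 2 := by norm_num
  constructor
  · intro hf
    refine ⟨?_, ?_, ?_⟩
    · have := shear_aux_box l1 l2 α s hs hf (fun _ => 0) (fun k => 2 ^ k) (fun k => by positivity)
        ?_ 0 1 1 1 (by simp) ?_
      · linarith
      · intro x y
        filter_upwards [Filter.eventually_gt_atTop y.toNat] with k hk h
        have h2 : k < 2 ^ k := Nat.lt_two_pow_self
        have h3 : ((2 ^ k : ℕ) : ℤ) = 2 ^ k := by push_cast; rfl
        have h4 := h.2
        rw [← h3] at h4
        omega
      · intro k
        have : (1 : ℝ) ≤ 2 ^ k := one_le_pow₀ two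
        simp
        linarith
    · have := shear_aux_box l1 l2 α s hs hf (fun k => -k) (fun k => 0) (fun k => le_rfl)
        ?_ (-1) (l1 - 1) (l2 - 1) (-1) (by simp) ?_
      · linarith
      · intro x y
        filter_upwards [Filter.eventually_gt_atTop x.natAbs] with k hk h
        have := h.1
        omega
      · intro k
        have hk : (0 : ℝ) ≤ k := by positivity
        have f1 : (2 : ℝ) ^ ((k : ℝ) * -1 * l1) ≤ 2 ^ ((k : ℝ) * -1) :=
          Real.rpow_le_rpow_of_exponent_le two (by nlinarith)
        have f2 : (2 : ℝ) ^ ((k : ℝ) * -1 * l2) ≤ 2 ^ ((k : ℝ) * -1) :=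
          Real.rpow_le_rpow_of_exponent_le two (by nlinarith)
        have f3 : (0 : ℝ) < 2 ^ ((k : ℝ) * -1) := by positivity
        have hc : (((-k : ℤ)) : ℝ) = (k : ℝ) * -1 := by push_cast; ring
        simp only [hc]
        rw [Int.cast_zero, zero_add, ← Real.rpow_add (by norm_num), ← Real.rpow_add (by norm_num),
          show (k : ℝ) * -1 * l1 + k * (l1 - 1) = k * -1 by ring,
          show (k : ℝ) * -1 * l2 + k * (l2 - 1) = k * -1 by ring]
        linarith
    · have := shear_aux_box l1 l2 α s hs hf (fun k => k) (fun k => 0) (fun k => le_rfl)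
        ?_ 1 (l2 - l1) 0 l2 (by simp) ?_
      · linarith
      · intro x y
        filter_upwards [Filter.eventually_gt_atTop x.natAbs] with k hk h
        have := h.1
        omega
      · intro k
        have hk : (0 : ℝ) ≤ k := by positivity
        have f1 : (2 : ℝ) ^ ((k : ℝ) * l1) ≤ 2 ^ ((k : ℝ) * l2) :=
          Real.rpow_le_rpow_of_exponent_le two (by nlinarith)
        have f2 : (2 : ℝ) ^ (k : ℝ) ≤ 2 ^ ((k : ℝ) * l2) :=
          Real.rpow_le_rpow_of_exponent_le two (by nlinarith)
        have f3 : (0 : ℝ) < 2 ^ ((k : ℝ) * l2) := by positivity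
        simp only [Int.cast_natCast]
        rw [Int.cast_zero, zero_add, ← Real.rpow_add (by norm_num), ← Real.rpow_add (by norm_num),
          show (k : ℝ) * l1 + k * (l2 - l1) = k * l2 by ring,
          show (k : ℝ) * l2 + k * 0 = k * l2 by ring]
        linarith
  · rintro ⟨hs2, hB, hA⟩
    exact shear_aux_suff l1 l2 α s h1 h12 hs2 hA hB
end
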